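/- Let n be a positive natural number and let M be an n×n real symmetric positive-definite matrix. Then for every index i, the i-th diagonal entry of the inverse matrix satisfies (M⁻¹)_{ii} ≥ 1/M_{ii}. -/

import Mathlib

theorem inv_diag_entry_ge_inv_of_diag (n : ℕ) (hn : 0 < n)
    (M : Matrix (Fin n) (Fin n) ℝ) (hsymm : M.IsSymm) (hpd : M.PosDef)
    (i : Fin n) : M⁻¹ i i ≥ 1 / M i i := by
  have ha : 0 < M i i := hpd.diag_pos
  have hdet : IsUnit M.det := (Matrix.isUnit_iff_isUnit_det M).1 hpd.isUnit
  have h1 : M⁻¹ * M = 1 := Matrix.nonsing_inv_mul M hdet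
  have h2 : M * M⁻¹ = 1 := Matrix.mul_nonsing_inv M hdet
  have hN : (M⁻¹).conjTranspose = M⁻¹ := hpd.inv.isHermitian
  have hp := hpd.posSemidef.conjTranspose_mul_mul_same
    (M⁻¹ - (M i i)⁻¹ • (1 : Matrix (Fin n) (Fin n) ℝ))
  have he : (M⁻¹ - (M i i)⁻¹ • (1 : Matrix (Fin n) (Fin n) ℝ)).conjTranspose * M *
      (M⁻¹ - (M i i)⁻¹ • (1 : Matrix (Fin n) (Fin n) ℝ)) =
      M⁻¹ - (M i i)⁻¹ • 1 - ((M i i)⁻¹ • 1 - (M i i)⁻¹ • (M i i)⁻¹ • M) := by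
    rw [Matrix.conjTranspose_sub, hN, Matrix.conjTranspose_smul, Matrix.conjTranspose_one]
    simp [sub_mul, mul_sub, h1, h2, smul_sub]
  rw [he] at hp
  have h := hp.diag_nonneg (i := i)
  simp at h
  rw [inv_mul_cancel₀ ha.ne'] at h
  rw [one_div]
  linarith
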